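/- G(1/(2p)) = O(log(p)/p) as p → ∞, where G(x) = x − Φ⁻¹(x)·φ(Φ⁻¹(x)). -/

import Mathlib

open Real MeasureTheory Filter Set Asymptotics

noncomputable def stdPdf (v : ℝ) : ℝ := (Real.sqrt (2 * Real.pi))⁻¹ * Real.exp (-(v ^ 2) / 2)
noncomputable def stdCdf (v : ℝ) : ℝ := ∫ t in Set.Iic v, stdPdf t
noncomputable def stdQuantile : ℝ → ℝ := Function.invFun stdCdf
noncomputable def Gfun (x : ℝ) : ℝ := x - stdQuantile x * stdPdf (stdQuantile x)

lemma stdPdf_eq (q s : ℝ) : stdPdf (s - q) = ProbabilityTheory.gaussianPDFReal q 1 s := by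
  simp [stdPdf, ProbabilityTheory.gaussianPDFReal]

lemma stdPdf_int (q : ℝ) : Integrable (fun s => stdPdf (s - q)) := by
  simp_rw [stdPdf_eq]
  exact ProbabilityTheory.integrable_gaussianPDFReal q 1

lemma stdPdf_int0 : Integrable stdPdf := by simpa using stdPdf_int 0

lemma stdPdf_one (q : ℝ) : ∫ s, stdPdf (s - q) = 1 := by
  simp_rw [stdPdf_eq]
  exact ProbabilityTheory.integral_gaussianPDFReal_eq_one q one_ne_zero

lemma stdPdf_pos (q : ℝ) : 0 < stdPdf q := by unfold stdPdf; positivity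

lemma stdPdf_anti {a b : ℝ} (h : a ^ 2 ≤ b ^ 2) : stdPdf b ≤ stdPdf a := by
  unfold stdPdf
  gcongr

lemma stdCdf_mono : Monotone stdCdf := by
  intro a b h
  apply setIntegral_mono_set stdPdf_int0.integrableOn
  · exact Eventually.of_forall fun x => (stdPdf_pos x).le
  · exact (Iic_subset_Iic.2 h).eventuallyLE

lemma stdCdf_cont : Continuous stdCdf := by
  have : stdCdf = fun v => stdCdf 0 + ∫ t in (0:ℝ)..v, stdPdf t := by
    funext v
    have := intervalIntegral.integral_Iic_sub_Iic (μ := volume) (f := stdPdf) (a := 0) (b := v)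
      stdPdf_int0.integrableOn stdPdf_int0.integrableOn
    unfold stdCdf
    linarith
  rw [this]
  exact continuous_const.add (intervalIntegral.continuous_primitive
    (fun a b => stdPdf_int0.intervalIntegrable) 0)

lemma stdCdf_upper {q : ℝ} (hq : q ≤ 0) : stdCdf q ≤ Real.exp (-(q ^ 2) / 2) := by
  have hi := (stdPdf_int q).const_mul (Real.exp (-(q ^ 2) / 2))
  calc stdCdf q ≤ ∫ s in Iic q, Real.exp (-(q ^ 2) / 2) * stdPdf (s - q) := by
        apply setIntegral_mono_on stdPdf_int0.integrableOn hi.integrableOn measurableSet_Iic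
        intro s hs
        have hs : s ≤ q := hs
        unfold stdPdf
        rw [mul_left_comm, ← Real.exp_add]
        gcongr
        nlinarith
    _ ≤ ∫ s, Real.exp (-(q ^ 2) / 2) * stdPdf (s - q) :=
        setIntegral_le_integral hi (Eventually.of_forall fun x =>
          mul_nonneg (Real.exp_pos _).le (stdPdf_pos _).le)
    _ = _ := by rw [integral_const_mul, stdPdf_one, mul_one]

lemma stdCdf_lower {q : ℝ} (hq : q ≤ -1) :
    -q * stdPdf q ≤ q ^ 2 * Real.exp (3 / 2) * stdCdf q := by
  have hq0 : q ≠ 0 := by linarith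
  have hinv : q⁻¹ < 0 := inv_lt_zero.2 (by linarith)
  have hmul : q * q⁻¹ = 1 := mul_inv_cancel₀ hq0
  have hinv1 : -1 ≤ q⁻¹ := by nlinarith
  have h1 : -q⁻¹ * stdPdf (q + q⁻¹) ≤ stdCdf q := by
    calc -q⁻¹ * stdPdf (q + q⁻¹) = ∫ s in Ioc (q + q⁻¹) q, stdPdf (q + q⁻¹) := by
          rw [setIntegral_const, smul_eq_mul, Measure.real, Real.volume_Ioc,
            ENNReal.toReal_ofReal (by linarith)]
          ring
      _ ≤ ∫ s in Ioc (q + q⁻¹) q, stdPdf s := by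
          apply setIntegral_mono_on (by simp) stdPdf_int0.integrableOn measurableSet_Ioc
          rintro s ⟨h1, h2⟩
          apply stdPdf_anti
          nlinarith
      _ ≤ stdCdf q := by
          apply setIntegral_mono_set stdPdf_int0.integrableOn
          · exact Eventually.of_forall fun x => (stdPdf_pos x).le
          · exact Ioc_subset_Iic_self.eventuallyLE
  have h2 : stdPdf q ≤ Real.exp (3 / 2) * stdPdf (q + q⁻¹) := by
    unfold stdPdf
    rw [mul_left_comm, ← Real.exp_add]
    gcongr
    nlinarith
  have h3 : -q = q ^ 2 * -q⁻¹ := by linear_combination q * hmul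
  calc -q * stdPdf q ≤ -q * (Real.exp (3 / 2) * stdPdf (q + q⁻¹)) :=
        mul_le_mul_of_nonneg_left h2 (by linarith)
    _ = q ^ 2 * Real.exp (3 / 2) * (-q⁻¹ * stdPdf (q + q⁻¹)) := by
        linear_combination (Real.exp (3 / 2) * stdPdf (q + q⁻¹)) * h3
    _ ≤ _ := mul_le_mul_of_nonneg_left h1 (by positivity)

lemma stdCdf_pos : 0 < stdCdf (-1) := by
  have h := stdCdf_lower (le_refl (-1))
  have h2 := stdPdf_pos (-1)
  by_contra hc
  have : Real.exp (3 / 2) * stdCdf (-1) ≤ 0 :=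
    mul_nonpos_of_nonneg_of_nonpos (Real.exp_pos _).le (not_lt.1 hc)
  linarith

lemma stdQuantile_spec {w : ℝ} (hw : 0 < w) (hw1 : w < stdCdf (-1)) :
    stdCdf (stdQuantile w) = w := by
  apply Function.invFun_eq
  apply mem_range_of_exists_le_of_exists_ge stdCdf_cont
  · have hb : Real.log w ≤ |Real.log w| := le_abs_self _
    have hb2 : -Real.log w ≤ |Real.log w| := neg_le_abs _
    refine ⟨-(2 * |Real.log w| + 1), (stdCdf_upper ?_).trans ?_⟩
    · linarith [abs_nonneg (Real.log w)]
    · rw [← Real.le_log_iff_exp_le hw]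
      nlinarith [abs_nonneg (Real.log w)]
  · exact ⟨-1, hw1.le⟩

theorem Gfun_isBigO :
    (fun p : ℕ => Gfun (1 / (2 * (p : ℝ)))) =O[atTop] fun p : ℕ => Real.log p / p := by
  apply IsBigO.of_bound (1 + 2 * Real.exp (3 / 2))
  have hp1 : ∀ᶠ p : ℕ in atTop, (1 / stdCdf (-1)) < (p : ℝ) :=
    tendsto_natCast_atTop_atTop.eventually (eventually_gt_atTop _)
  filter_upwards [hp1, eventually_ge_atTop 2] with p hp hp2
  have hp2' : (2 : ℝ) ≤ p := by exact_mod_cast hp2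
  have hp0 : (0 : ℝ) < p := by linarith
  have hc := stdCdf_pos
  have hw0 : 0 < 1 / (2 * (p : ℝ)) := by positivity
  have hw1 : 1 / (2 * (p : ℝ)) < stdCdf (-1) := by
    rw [div_lt_iff₀ hc] at hp
    rw [div_lt_iff₀ (by positivity)]
    nlinarith
  have hs := stdQuantile_spec hw0 hw1
  unfold Gfun
  have hlogw : Real.log (1 / (2 * (p : ℝ))) = -(Real.log 2 + Real.log p) := by
    rw [one_div, Real.log_inv, Real.log_mul two_ne_zero hp0.ne']
  have hlog2 : Real.log 2 ≤ Real.log p := Real.log_le_log two_pos hp2'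
  have hl := Real.log_two_gt_d9
  have hwp : 1 / (2 * (p : ℝ)) = (1 / 2) / p := by field_simp
  generalize 1 / (2 * (p : ℝ)) = w at *
  generalize stdQuantile w = q at *
  have hq : q ≤ -1 := by
    by_contra h
    have := stdCdf_mono (not_le.1 h).le
    linarith
  have hlow := stdCdf_lower hq
  have hup := stdCdf_upper (show q ≤ 0 by linarith)
  rw [hs] at hlow hup
  rw [← Real.log_le_iff_le_exp hw0, hlogw] at hup
  have hq2 : q ^ 2 ≤ 4 * Real.log p := by linarith
  have hqp : 0 ≤ -q * stdPdf q := mul_nonneg (by linarith) (stdPdf_pos q).le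
  rw [Real.norm_of_nonneg (by linarith), Real.norm_of_nonneg (by apply div_nonneg <;> linarith)]
  have hA : w ≤ Real.log p / p := by
    rw [hwp]; gcongr; linarith
  have hB : q ^ 2 * Real.exp (3 / 2) * w ≤ 2 * Real.exp (3 / 2) * (Real.log p / p) := by
    calc q ^ 2 * Real.exp (3 / 2) * w ≤ (4 * Real.log p) * Real.exp (3 / 2) * w := by gcongr
      _ = _ := by rw [hwp]; ring
  linarith
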